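/- Let y ∈ W^{1,p}(Ω;ℝ³) with det ∇y > 0 almost everywhere in Ω. Then Ω^y = {ξ ∈ ℝ³ \ y(∂Ω) : deg(y,Ω,ξ) > 0}. In particular, Ω^y coincides with the topological image im_T(y,Ω) := {ξ ∈ ℝ³ \ y(∂Ω) : deg(y,Ω,ξ) ≠ 0}. -/

import Mathlib

noncomputable section
open MeasureTheory Set Filter Topology

/-- We model `ℝ³` as `Fin 3 → ℝ` (with Lebesgue measure `volume`). -/
abbrev V3 := Fin 3 → ℝ
/-- 3×3 real matrices. -/
abbrev M3 := Matrix (Fin 3) (Fin 3) ℝ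

/-- Euclidean norm of a vector in `ℝ³`. -/
def vnorm (v : V3) : ℝ := Real.sqrt (∑ i, (v i) ^ 2)

/-- Frobenius norm of a matrix. -/
def mnorm (A : M3) : ℝ := Real.sqrt (∑ i, ∑ j, (A i j) ^ 2)

/-- The (a.e.-defined) gradient matrix of `y : ℝ³ → ℝ³`, `(∇y)_{ij} = ∂_j y_i`. -/
def gradM (y : V3 → V3) (x : V3) : M3 := Matrix.of fun i j => fderiv ℝ y x (Pi.single j 1) i

/-- Jacobian determinant `det ∇y`. -/
def detG (y : V3 → V3) (x : V3) : ℝ := (gradM y x).det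

/-- Cofactor matrix `cof A` (transpose of the adjugate). -/
def cofM (A : M3) : M3 := Matrix.transpose (Matrix.adjugate A)

/-- `adj A`, the transpose of the cofactor matrix (the classical adjugate). -/
def adjM (A : M3) : M3 := Matrix.adjugate A

/-- Gradient (as a vector) of a scalar function on `ℝ³`. -/
def gradS (φ : V3 → ℝ) (ξ : V3) : V3 := fun j => fderiv ℝ φ ξ (Pi.single j 1)

/-- Divergence of a vector field on `ℝ³`. -/
def divV (ψ : V3 → V3) (ξ : V3) : ℝ := ∑ i, fderiv ℝ ψ ξ (Pi.single i 1) i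

/-- The deformed configuration `Ω^y := y(Ω) \ y(∂Ω)`. -/
def defConfig (y : V3 → V3) (Ω : Set V3) : Set V3 := y '' Ω \ y '' frontier Ω

/-- `y` is almost everywhere injective on `Ω`: injective off a Lebesgue-null set. -/
def AEInjOn (y : V3 → V3) (Ω : Set V3) : Prop :=
  ∃ X ⊆ Ω, volume X = 0 ∧ Set.InjOn y (Ω \ X)

/-- Membership in `W^{1,p}(Ω;ℝ³)` (`p > 3`), identified with the continuous representative:
continuity up to the boundary, a.e. differentiability, and `L^p`-integrability of the
gradient. -/
def W1p (y : V3 → V3) (Ω : Set V3) (p : ℝ) : Prop :=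
  ContinuousOn y (closure Ω) ∧
  (∀ᵐ x ∂volume.restrict Ω, DifferentiableAt ℝ y x) ∧
  (∫⁻ x in Ω, ENNReal.ofReal (mnorm (gradM y x) ^ p)) < ⊤

/-- Lusin property (N) on a set `s`: null sets are mapped to null sets. -/
def LusinN (y : V3 → V3) (s : Set V3) : Prop :=
  ∀ A ⊆ s, volume A = 0 → volume (y '' A) = 0

/-- The Jacobian is controlled by the `p`-th power of the norm of the gradient. -/
theorem abs_det_le_mnorm_rpow (A : M3) (p : ℝ) (hp : 3 < p) :
    |A.det| ≤ 6 * (1 + mnorm A ^ p) := by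
  have h0 : 0 ≤ mnorm A := Real.sqrt_nonneg _
  have hent : ∀ i j, |A i j| ≤ mnorm A := by
    intro i j
    apply Real.abs_le_sqrt
    calc (A i j) ^ 2 ≤ ∑ j, (A i j) ^ 2 :=
          Finset.single_le_sum (f := fun j => (A i j) ^ 2) (fun _ _ => sq_nonneg _)
            (Finset.mem_univ j)
      _ ≤ ∑ i, ∑ j, (A i j) ^ 2 :=
          Finset.single_le_sum (f := fun i => ∑ j, (A i j) ^ 2)
            (fun _ _ => Finset.sum_nonneg fun _ _ => sq_nonneg _) (Finset.mem_univ i)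
  have h1 : |A.det| ≤ 6 * mnorm A ^ 3 := by
    have := Matrix.det_le (abv := AbsoluteValue.abs) (A := A) (x := mnorm A) hent
    simpa [Nat.factorial] using this
  have h2 : mnorm A ^ (3 : ℕ) ≤ 1 + mnorm A ^ p := by
    have hpp : 0 ≤ mnorm A ^ p := Real.rpow_nonneg h0 p
    rcases le_total (mnorm A) 1 with h | h
    · have : mnorm A ^ 3 ≤ 1 := pow_le_one₀ h0 h
      linarith
    · have : mnorm A ^ (3 : ℝ) ≤ mnorm A ^ p := Real.rpow_le_rpow_of_exponent_le h hp.le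
      have h3 : mnorm A ^ (3 : ℝ) = mnorm A ^ (3 : ℕ) := by
        exact_mod_cast Real.rpow_natCast (mnorm A) 3
      rw [h3] at this
      exact this.trans (le_add_of_nonneg_left zero_le_one)
  linarith

theorem measurable_gradM_entry (y : V3 → V3) (i j : Fin 3) :
    Measurable fun x => gradM y x i j := by
  have h : Measurable fun x => fderiv ℝ y x (Pi.single j 1) :=
    measurable_fderiv_apply_const ℝ y _
  exact (measurable_pi_apply i).comp h

theorem measurable_detG (y : V3 → V3) : Measurable (detG y) := by
  unfold detG
  simp only [Matrix.det_fin_three]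
  have := measurable_gradM_entry y
  fun_prop

theorem measurable_mnorm_gradM (y : V3 → V3) : Measurable fun x => mnorm (gradM y x) := by
  unfold mnorm
  have := measurable_gradM_entry y
  fun_prop

theorem integrable_detG (Ω : Set V3) (hΩb : Bornology.IsBounded Ω)
    (p : ℝ) (hp : 3 < p) (y : V3 → V3) (hy : W1p y Ω p) :
    Integrable (detG y) (volume.restrict Ω) := by
  have : IsFiniteMeasure (volume.restrict Ω) :=
    ⟨by rw [Measure.restrict_apply_univ]; exact hΩb.measure_lt_top⟩
  have hg : Integrable (fun x => mnorm (gradM y x) ^ p) (volume.restrict Ω) := by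
    refine ⟨((measurable_mnorm_gradM y).pow_const p).aestronglyMeasurable, ?_⟩
    rw [hasFiniteIntegral_iff_ofReal]
    · exact hy.2.2
    · exact Eventually.of_forall fun x => Real.rpow_nonneg (Real.sqrt_nonneg _) p
  refine Integrable.mono' (((integrable_const (1 : ℝ)).add hg).const_mul 6)
    (measurable_detG y).aestronglyMeasurable (Eventually.of_forall fun x => ?_)
  exact abs_det_le_mnorm_rpow (gradM y x) p hp

/-- Deformed configuration via the topological degree.
Let `Ω ⊂ ℝ³` be a bounded Lipschitz domain, `p > 3`, `y ∈ W^{1,p}(Ω;ℝ³)` with `det ∇y > 0` a.e.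
Let `deg` be the topological degree of `y` on `Ω`, i.e. an integer-valued function, continuous on
`ℝ³ \ y(∂Ω)`, satisfying the integral formula and the solvability property. Then
`Ω^y = {ξ ∉ y(∂Ω) : deg(y,Ω,ξ) > 0}`; in particular `Ω^y` coincides with the topological image
`im_T(y,Ω) = {ξ ∉ y(∂Ω) : deg(y,Ω,ξ) ≠ 0}`. -/
theorem deformed_configuration_eq_positive_degree
    (Ω : Set V3) (hΩo : IsOpen Ω) (hΩb : Bornology.IsBounded Ω) (hΩne : Ω.Nonempty)
    (p : ℝ) (hp : 3 < p)
    (y : V3 → V3) (hy : W1p y Ω p)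
    (hdet : ∀ᵐ x ∂volume.restrict Ω, 0 < detG y x)
    (deg : V3 → ℤ)
    (hdeg_cont : ContinuousOn (fun ξ => (deg ξ : ℝ)) (y '' frontier Ω)ᶜ)
    (hdeg_int : ∀ ξ ∉ y '' frontier Ω, ∀ ψ : V3 → ℝ,
      ContDiff ℝ (⊤ : ℕ∞) ψ → HasCompactSupport ψ →
      tsupport ψ ⊆ connectedComponentIn (y '' frontier Ω)ᶜ ξ →
      (∫ t, ψ t) = 1 →
      (deg ξ : ℝ) = ∫ x in Ω, ψ (y x) * detG y x)
    (hdeg_solv : ∀ ξ ∉ y '' frontier Ω, deg ξ ≠ 0 → ξ ∈ y '' Ω) :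
    defConfig y Ω = {ξ | ξ ∉ y '' frontier Ω ∧ 0 < deg ξ} ∧
    defConfig y Ω = {ξ | ξ ∉ y '' frontier Ω ∧ deg ξ ≠ 0} := by
  have hyc : ContinuousOn y (closure Ω) := hy.1
  have hK : IsCompact (y '' frontier Ω) := by
    have hc : IsCompact (closure Ω) := hΩb.isCompact_closure
    exact (hc.of_isClosed_subset isClosed_frontier frontier_subset_closure).image_of_continuousOn
      (hyc.mono frontier_subset_closure)
  have key : ∀ ξ ∈ defConfig y Ω, 0 < deg ξ := by
    rintro ξ ⟨⟨x₀, hx₀, rfl⟩, hξ⟩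
    have hCo : IsOpen (connectedComponentIn (y '' frontier Ω)ᶜ (y x₀)) :=
      hK.isClosed.isOpen_compl.connectedComponentIn
    obtain ⟨r, hr, hrC⟩ := Metric.isOpen_iff.1 hCo _ (mem_connectedComponentIn hξ)
    let f : ContDiffBump (y x₀) := ⟨r / 4, r / 2, by positivity, by linarith⟩
    have hfs : tsupport (f.normed volume) ⊆ connectedComponentIn (y '' frontier Ω)ᶜ (y x₀) := by
      rw [f.tsupport_normed_eq]
      exact (Metric.closedBall_subset_ball (by show r / 2 < r; linarith)).trans hrC
    have hint := hdeg_int (y x₀) hξ (f.normed volume) f.contDiff_normed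
      f.hasCompactSupport_normed hfs f.integral_normed
    have hyΩ : ContinuousOn y Ω := hyc.mono subset_closure
    have hψc : Continuous (f.normed volume) := f.continuous_normed
    have hmeas : AEStronglyMeasurable (fun x => f.normed volume (y x)) (volume.restrict Ω) :=
      (hψc.comp_continuousOn hyΩ).aestronglyMeasurable hΩo.measurableSet
    have hI : Integrable (fun x => f.normed volume (y x) * detG y x) (volume.restrict Ω) := by
      obtain ⟨c, hc⟩ := hψc.bounded_above_of_compact_support f.hasCompactSupport_normed
      exact (integrable_detG Ω hΩb p hp y hy).bdd_mul hmeas (Eventually.of_forall fun x => hc (y x))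
    have hpos : 0 < ∫ x in Ω, f.normed volume (y x) * detG y x := by
      have hnn : 0 ≤ᵐ[volume.restrict Ω] fun x => f.normed volume (y x) * detG y x := by
        filter_upwards [hdet] with x hx
        exact mul_nonneg (f.nonneg_normed _) hx.le
      rw [integral_pos_iff_support_of_nonneg_ae hnn hI]
      have hUo : IsOpen (Ω ∩ y ⁻¹' Metric.ball (y x₀) (r / 2)) :=
        hyΩ.isOpen_inter_preimage hΩo Metric.isOpen_ball
      have hUpos : 0 < volume (Ω ∩ y ⁻¹' Metric.ball (y x₀) (r / 2)) :=
        hUo.measure_pos volume ⟨x₀, hx₀, Metric.mem_ball_self (by positivity)⟩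
      have hUr : volume.restrict Ω (Ω ∩ y ⁻¹' Metric.ball (y x₀) (r / 2)) =
          volume (Ω ∩ y ⁻¹' Metric.ball (y x₀) (r / 2)) := by
        rw [Measure.restrict_apply hUo.measurableSet, inter_right_comm, inter_self]
      rw [← hUr] at hUpos
      refine hUpos.trans_le (measure_mono_ae ?_)
      filter_upwards [hdet] with x hx hxU
      have hs : y x ∈ Function.support (f.normed volume) := by
        rw [f.support_normed_eq]
        exact hxU.2
      exact mul_ne_zero hs hx.ne'
    rw [← hint] at hpos
    exact_mod_cast hpos
  constructor
  · ext ξ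
    exact ⟨fun h => ⟨h.2, key ξ h⟩, fun h => ⟨hdeg_solv ξ h.1 h.2.ne', h.1⟩⟩
  · ext ξ
    exact ⟨fun h => ⟨h.2, (key ξ h).ne'⟩, fun h => ⟨hdeg_solv ξ h.1 h.2, h.1⟩⟩
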